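/- Let S be a finite subset of ℝ² such that the convex hull K of S has nonempty interior E, and let k ≥ 1 be an integer. Let q : ℝ² → ℝ be a polynomial function of total degree at most k such that q vanishes at every point of the topological frontier of K, and such that ∫_E q(x) p(x) dx = 0 for every polynomial function p : ℝ² → ℝ of total degree at most k − 2 (this second condition is vacuous for k = 1). Then q is identically zero. -/

import Mathlib

open MeasureTheory

noncomputable section

abbrev Plane := EuclideanSpace ℝ (Fin 2)

/-- `f` is (the restriction of) a real polynomial function on `ℝ²` of total degree at most `m`. -/
def IsPolyDeg (m : ℕ) (f : Plane → ℝ) : Prop :=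
  ∃ P : MvPolynomial (Fin 2) ℝ, P.totalDegree ≤ m ∧ ∀ x, f x = MvPolynomial.eval (fun i => x i) P

def lin (a b d : ℝ) : MvPolynomial (Fin 2) ℝ :=
  MvPolynomial.C d - MvPolynomial.C a * MvPolynomial.X 0 - MvPolynomial.C b * MvPolynomial.X 1

lemma lin_eval (a b d : ℝ) (x : Fin 2 → ℝ) :
    MvPolynomial.eval x (lin a b d) = d - a * x 0 - b * x 1 := by
  simp [lin]

lemma lin_deg {a b : ℝ} (d : ℝ) (h : a ^ 2 + b ^ 2 ≠ 0) : 1 ≤ (lin a b d).totalDegree := by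
  by_contra hc
  have h0 : (lin a b d).totalDegree = 0 := by omega
  rw [MvPolynomial.totalDegree_eq_zero_iff_eq_C] at h0
  have h1 := congrArg (MvPolynomial.eval (![0, 0] : Fin 2 → ℝ)) h0
  have h2 := congrArg (MvPolynomial.eval (![a, b] : Fin 2 → ℝ)) h0
  rw [lin_eval, MvPolynomial.eval_C] at h1 h2
  simp at h1 h2
  apply h
  linarith

lemma lin_dvd {a b : ℝ} (d : ℝ) (h : a ^ 2 + b ^ 2 ≠ 0) (P : MvPolynomial (Fin 2) ℝ)
    (A : Set (Fin 2 → ℝ)) (hA : A.Infinite) (hl : ∀ x ∈ A, a * x 0 + b * x 1 = d)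
    (hP : ∀ x ∈ A, MvPolynomial.eval x P = 0) : lin a b d ∣ P := by
  set n := a ^ 2 + b ^ 2 with hn
  let pr : Fin 2 → Polynomial ℝ :=
    ![Polynomial.C (a * d / n) - Polynomial.C b * Polynomial.X,
      Polynomial.C (b * d / n) + Polynomial.C a * Polynomial.X]
  let Q : Polynomial ℝ := MvPolynomial.aeval pr P
  let τ : MvPolynomial (Fin 2) ℝ := MvPolynomial.C (1 / n) *
    (MvPolynomial.C a * MvPolynomial.X 1 - MvPolynomial.C b * MvPolynomial.X 0)
  let cur : ℝ → Fin 2 → ℝ := fun t => ![a * d / n - b * t, b * d / n + a * t]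
  have hev : ∀ (R : MvPolynomial (Fin 2) ℝ) (t : ℝ),
      (MvPolynomial.aeval pr R).eval t = MvPolynomial.eval (cur t) R := by
    intro R t
    induction R using MvPolynomial.induction_on with
    | C c => simp
    | add p q hp hq => simp [hp, hq]
    | mul_X p i hp =>
      simp only [map_mul, Polynomial.eval_mul, hp, MvPolynomial.aeval_X, MvPolynomial.eval_X]
      congr 1
      fin_cases i <;> simp [pr, cur]
  have hQ : Q = 0 := by
    apply Polynomial.eq_zero_of_infinite_isRoot
    by_contra hfin
    rw [Set.not_infinite] at hfin
    apply hA
    apply (hfin.image cur).subset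
    intro x hx
    have hx' := hl x hx
    have hc : cur ((a * x 1 - b * x 0) / n) = x := by
      funext i
      fin_cases i
      · simp only [cur]
        simp
        field_simp
        rw [← hx', hn]; ring
      · simp only [cur]
        simp
        field_simp
        rw [← hx', hn]; ring
    refine ⟨(a * x 1 - b * x 0) / n, ?_, hc⟩
    show Polynomial.eval _ Q = 0
    rw [hev, hc, hP x hx]
  have key : ∀ R : MvPolynomial (Fin 2) ℝ,
      lin a b d ∣ R - Polynomial.aeval τ (MvPolynomial.aeval pr R) := by
    intro R
    induction R using MvPolynomial.induction_on with
    | C c => simp [MvPolynomial.algebraMap_eq]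
    | add p q hp hq =>
      have := dvd_add hp hq
      simp only [map_add]
      convert this using 1
      ring
    | mul_X p i hp =>
      have hX : lin a b d ∣ MvPolynomial.X i - Polynomial.aeval τ (pr i) := by
        fin_cases i
        · refine ⟨MvPolynomial.C (- a / n), ?_⟩
          apply MvPolynomial.funext
          intro x
          simp [pr, τ, lin, MvPolynomial.algebraMap_eq]
          field_simp
          rw [hn]; ring
        · refine ⟨MvPolynomial.C (- b / n), ?_⟩
          apply MvPolynomial.funext
          intro x
          simp [pr, τ, lin, MvPolynomial.algebraMap_eq]
          field_simp
          rw [hn]; ring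
      have := dvd_add (hp.mul_right (MvPolynomial.X i))
        (hX.mul_left (Polynomial.aeval τ (MvPolynomial.aeval pr p)))
      simp only [map_mul, MvPolynomial.aeval_X]
      convert this using 1
      ring
  have := key P
  change lin a b d ∣ P - Polynomial.aeval τ Q at this
  simpa [hQ] using this

lemma zero_of_open (P : MvPolynomial (Fin 2) ℝ) (E : Set Plane) (hE : IsOpen E) (hne : E.Nonempty)
    (h : ∀ x ∈ E, MvPolynomial.eval (fun i => x i) P = 0) : P = 0 := by
  obtain ⟨c, hc⟩ := hne
  let e := (EuclideanSpace.equiv (Fin 2) ℝ)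
  have ho : IsOpen (e.symm ⁻¹' E) := hE.preimage e.symm.continuous
  obtain ⟨ε, hε, hb⟩ := Metric.isOpen_iff.1 ho (e c) (by simpa using hc)
  apply MvPolynomial.funext_set (fun i => Metric.ball (e c i) ε)
  · intro i
    rw [Real.ball_eq_Ioo]
    exact Set.Ioo_infinite (by linarith)
  · intro x hx
    have : x ∈ Metric.ball (e c) ε := by
      rw [ball_pi _ hε]; exact hx
    have := h _ (hb this)
    simpa [e] using this

/-- frontier point off `S` in a half plane -/
lemma exists_pt (S : Finset Plane) (c : Plane)
    (hc : c ∈ interior (convexHull ℝ (S : Set Plane))) (α β : ℝ) (h : α ^ 2 + β ^ 2 ≠ 0) :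
    ∃ y ∈ frontier (convexHull ℝ (S : Set Plane)), y ∉ S ∧
      α * y 0 + β * y 1 ≤ α * c 0 + β * c 1 := by
  have hK : IsCompact (convexHull ℝ (S : Set Plane)) := S.finite_toSet.isCompact_convexHull ℝ
  set K := convexHull ℝ (S : Set Plane) with hKdef
  have hn : 0 < α ^ 2 + β ^ 2 := lt_of_le_of_ne (by positivity) h.symm
  let v : ℝ → Plane := fun s => !₂[-α - s * β, -β + s * α]
  have hv : ∀ s, v s ≠ 0 := by
    intro s h0
    have h1 := congrFun (congrArg WithLp.ofLp h0) 0
    have h2 := congrFun (congrArg WithLp.ofLp h0) 1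
    simp [v] at h1 h2
    apply h
    linear_combination -α * h1 - β * h2
  have hex : ∀ s : ℝ, ∃ t : ℝ, 0 < t ∧ c + t • v s ∈ frontier K := by
    intro s
    have hconn : IsPreconnected ((fun t : ℝ => c + t • v s) '' Set.Ioi 0) :=
      isPreconnected_Ioi.image _ (by fun_prop)
    have h1 : (((fun t : ℝ => c + t • v s) '' Set.Ioi 0) ∩ interior K).Nonempty := by
      have hcont : Filter.Tendsto (fun t : ℝ => c + t • v s) (nhdsWithin 0 (Set.Ioi 0)) (nhds c) := by
        have : Continuous (fun t : ℝ => c + t • v s) := by fun_prop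
        have := this.tendsto 0
        simp only [zero_smul, add_zero] at this
        exact this.mono_left nhdsWithin_le_nhds
      have := (hcont.eventually (isOpen_interior.mem_nhds hc)).and self_mem_nhdsWithin
      obtain ⟨t, ht, ht0⟩ := this.exists
      exact ⟨_, ⟨t, ht0, rfl⟩, ht⟩
    have h2 : (((fun t : ℝ => c + t • v s) '' Set.Ioi 0) ∩ Kᶜ).Nonempty := by
      obtain ⟨R, hR⟩ := hK.isBounded.subset_closedBall c
      have hp : 0 < ‖v s‖ := norm_pos_iff.2 (hv s)
      refine ⟨_, ⟨(|R| + 1) / ‖v s‖, by simp only [Set.mem_Ioi]; positivity, rfl⟩, ?_⟩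
      intro hmem
      have := hR hmem
      rw [Metric.mem_closedBall, dist_eq_norm, add_sub_cancel_left, norm_smul, Real.norm_eq_abs,
        abs_of_pos (by positivity), div_mul_cancel₀ _ hp.ne'] at this
      have := le_abs_self R
      linarith
    by_contra hcon
    push Not at hcon
    obtain ⟨z, -, hz1, hz2⟩ := hconn _ _ isOpen_interior hK.isClosed.isOpen_compl (by
      rintro _ ⟨t, ht, rfl⟩
      by_cases hin : c + t • v s ∈ K
      · left
        by_contra hni
        apply hcon t ht
        rw [hK.isClosed.frontier_eq]
        exact ⟨hin, hni⟩
      · exact Or.inr hin) h1 h2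
    exact hz2 (interior_subset hz1)
  choose t ht hfr using hex
  have hinj : Function.Injective (fun s => c + t s • v s) := by
    intro s s' hs
    have hs := add_left_cancel hs
    have h1 := congrFun (congrArg WithLp.ofLp hs) 0
    have h2 := congrFun (congrArg WithLp.ofLp hs) 1
    simp [v] at h1 h2
    have e1 : t s = t s' := by
      have : (t s - t s') * (α ^ 2 + β ^ 2) = 0 := by linear_combination -α * h1 - β * h2
      rcases mul_eq_zero.1 this with h' | h'
      · linarith
      · exact absurd h' h
    rw [← e1] at h1 h2
    have : (s - s') * (t s * (α ^ 2 + β ^ 2)) = 0 := by linear_combination -β * h1 + α * h2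
    rcases mul_eq_zero.1 this with h' | h'
    · linarith
    · exact absurd h' (mul_pos (ht s) hn).ne'
  obtain ⟨y, ⟨s, rfl⟩, hy⟩ := (Set.infinite_range_of_injective hinj).exists_notMem_finset S
  refine ⟨_, hfr s, hy, ?_⟩
  have := mul_pos (ht s) hn
  simp [v]
  nlinarith

lemma exists_edge (S : Finset Plane) (c : Plane)
    (hc : c ∈ interior (convexHull ℝ (S : Set Plane))) (α β : ℝ) (h : α ^ 2 + β ^ 2 ≠ 0) :
    ∃ a b d : ℝ, ∃ y : Plane, a ^ 2 + b ^ 2 ≠ 0 ∧ a * y 0 + b * y 1 = d ∧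
      α * y 0 + β * y 1 ≤ α * c 0 + β * c 1 ∧
      (∀ x ∈ interior (convexHull ℝ (S : Set Plane)), a * x 0 + b * x 1 < d) ∧
      ∃ A : Set (Fin 2 → ℝ), A.Infinite ∧ ∀ x ∈ A, a * x 0 + b * x 1 = d ∧
        WithLp.toLp 2 x ∈ frontier (convexHull ℝ (S : Set Plane)) := by
  obtain ⟨y, hyf, hyS, hyc⟩ := exists_pt S c hc α β h
  have hK : IsCompact (convexHull ℝ (S : Set Plane)) := S.finite_toSet.isCompact_convexHull ℝ
  have hconv : Convex ℝ (convexHull ℝ (S : Set Plane)) := convex_convexHull ℝ _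
  have hext : y ∉ (convexHull ℝ (S : Set Plane)).extremePoints ℝ :=
    fun hy => hyS (by simpa using extremePoints_convexHull_subset hy)
  set K := convexHull ℝ (S : Set Plane) with hKdef
  have hyf' := hyf
  rw [hK.isClosed.frontier_eq] at hyf'
  obtain ⟨hyK, hyI⟩ := hyf'
  obtain ⟨f, hf⟩ := geometric_hahn_banach_open_point hconv.interior isOpen_interior hyI
  have hfx : ∀ x : Plane, f x = f (EuclideanSpace.single 0 1) * x 0
      + f (EuclideanSpace.single 1 1) * x 1 := by
    intro x
    have : x = x 0 • EuclideanSpace.single 0 1 + x 1 • EuclideanSpace.single 1 1 := by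
      ext i; fin_cases i <;> simp
    conv_lhs => rw [this]
    simp [mul_comm]
  have hle : ∀ x ∈ K, f x ≤ f y := by
    intro x hx
    have : x ∈ closure (interior K) := by
      rw [hconv.closure_interior_eq_closure_of_nonempty_interior ⟨c, hc⟩]
      exact subset_closure hx
    exact closure_minimal (fun z hz => (hf z hz).le)
      (isClosed_le f.continuous continuous_const) this
  have hpp : ∃ p ∈ K, ∃ p' ∈ K, p ≠ p' ∧ y ∈ openSegment ℝ p p' := by
    by_contra hcon
    push Not at hcon
    apply hext
    rw [mem_extremePoints_iff_left]
    refine ⟨hyK, fun p hp p' hp' hy => ?_⟩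
    by_contra hne
    refine hcon p hp p' hp' ?_ hy
    rintro rfl
    simp at hy
    exact hne hy.symm
  obtain ⟨p, hp, p', hp', hne, s, s', hs, hs', hss, hy⟩ := hpp
  have hfy : s * f p + s' * f p' = f y := by rw [← hy]; simp
  have h1 := hle p hp
  have h2 := hle p' hp'
  have e1 : f p = f y := by
    have : s * f y + s' * f y = f y := by rw [← add_mul, hss, one_mul]
    nlinarith
  have e2 : f p' = f y := by
    have : s * f y + s' * f y = f y := by rw [← add_mul, hss, one_mul]
    nlinarith
  refine ⟨f (EuclideanSpace.single 0 1), f (EuclideanSpace.single 1 1), f y, y, ?_, (hfx y).symm,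
    hyc, fun x hx => by rw [← hfx]; exact hf x hx, WithLp.ofLp '' segment ℝ p p', ?_, ?_⟩
  · intro h0
    have ha : f (EuclideanSpace.single 0 1) = 0 := by nlinarith [sq_nonneg (f (EuclideanSpace.single 0 1)), sq_nonneg (f (EuclideanSpace.single 1 1))]
    have hb : f (EuclideanSpace.single 1 1) = 0 := by nlinarith [sq_nonneg (f (EuclideanSpace.single 0 1)), sq_nonneg (f (EuclideanSpace.single 1 1))]
    have := hf c hc
    rw [hfx c, hfx y, ha, hb] at this
    simp at this
  · apply Set.Infinite.image (WithLp.ofLp_injective 2).injOn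
    rw [segment_eq_image_lineMap]
    exact (Set.Icc_infinite zero_lt_one).image (AffineMap.lineMap_injective ℝ hne).injOn
  · rintro _ ⟨x, hx, rfl⟩
    have hxK := hconv.segment_subset hp hp' hx
    have hxf : f x = f y := by
      obtain ⟨u, u', hu, hu', huu, rfl⟩ := hx
      simp [e1, e2, ← add_mul, huu]
    refine ⟨by rw [← hfx, hxf], ?_⟩
    rw [hK.isClosed.frontier_eq]
    exact ⟨hxK, fun hxi => (hf x hxi).ne hxf⟩

/-- unisolvence property (4.3) of the paper: if `K` is the convex
hull of a finite set `S ⊂ ℝ²` with nonempty interior `E`, and `q` is a polynomial of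
total degree `≤ k` vanishing on the frontier of `K` and with vanishing moments on `E`
against all polynomials of total degree `≤ k − 2`, then `q ≡ 0`.  (The moment
condition is vacuous for `k = 1`.) -/
theorem statement7
    (S : Finset Plane)
    (hE : (interior (convexHull ℝ (S : Set Plane))).Nonempty)
    (k : ℕ) (hk : 1 ≤ k)
    (q : Plane → ℝ) (hq : IsPolyDeg k q)
    (hbd : ∀ x ∈ frontier (convexHull ℝ (S : Set Plane)), q x = 0)
    (hmom : ∀ p : Plane → ℝ,
      (∃ P : MvPolynomial (Fin 2) ℝ, (P.totalDegree : ℤ) ≤ (k : ℤ) - 2 ∧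
        ∀ x, p x = MvPolynomial.eval (fun i => x i) P) →
      ∫ x in interior (convexHull ℝ (S : Set Plane)), q x * p x = 0) :
    ∀ x, q x = 0 := by
  obtain ⟨P, hPd, hqP⟩ := hq
  obtain ⟨c, hc⟩ := hE
  obtain ⟨a, b, d, -, hn1, -, -, hpos1, A, hA, hAl⟩ := exists_edge S c hc 1 0 (by norm_num)
  obtain ⟨a', b', d', y, hn2, hy2, hyc, hpos2, B, hB, hBl⟩ := exists_edge S c hc a b hn1
  have hK : IsCompact (convexHull ℝ (S : Set Plane)) := S.finite_toSet.isCompact_convexHull ℝ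
  have hPf : ∀ x : Fin 2 → ℝ, WithLp.toLp 2 x ∈ frontier (convexHull ℝ (S : Set Plane)) →
      MvPolynomial.eval x P = 0 := by
    intro x hx
    rw [← hbd _ hx, hqP]
  suffices hP0 : P = 0 by
    intro x; rw [hqP, hP0, map_zero]
  by_contra hP0
  obtain ⟨R, hR⟩ := lin_dvd d hn1 P A hA (fun x hx => (hAl x hx).1) (fun x hx => hPf x (hAl x hx).2)
  have hnd : ¬ lin a' b' d' ∣ lin a b d := by
    rintro ⟨W, hW⟩
    have := congrArg (MvPolynomial.eval (fun i => y i)) hW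
    rw [map_mul, lin_eval, lin_eval] at this
    have h0 : d' - a' * y 0 - b' * y 1 = 0 := by linarith
    rw [h0, zero_mul] at this
    have := hpos1 c hc
    linarith
  have hR2 : lin a' b' d' ∣ R := by
    let B1 := {x ∈ B | MvPolynomial.eval x (lin a b d) = 0}
    let B2 := {x ∈ B | MvPolynomial.eval x R = 0}
    have hB12 : B ⊆ B1 ∪ B2 := by
      intro x hx
      have := hPf x (hBl x hx).2
      rw [hR, map_mul] at this
      rcases mul_eq_zero.1 this with h | h
      · exact Or.inl ⟨hx, h⟩
      · exact Or.inr ⟨hx, h⟩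
    rcases Set.infinite_union.1 (hB.mono hB12) with h | h
    · exact absurd (lin_dvd d' hn2 _ B1 h (fun x hx => (hBl x hx.1).1) (fun x hx => hx.2)) hnd
    · exact lin_dvd d' hn2 _ B2 h (fun x hx => (hBl x hx.1).1) (fun x hx => hx.2)
  obtain ⟨T, rfl⟩ := hR2
  have hl1 : lin a b d ≠ 0 := fun h => hP0 (by rw [hR, h, zero_mul])
  have hl2 : lin a' b' d' ≠ 0 := fun h => hP0 (by rw [hR, h]; simp)
  have hT : T ≠ 0 := fun h => hP0 (by rw [hR, h]; simp)
  have hdeg : (T.totalDegree : ℤ) ≤ (k : ℤ) - 2 := by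
    rw [hR, MvPolynomial.totalDegree_mul_of_isDomain hl1 (mul_ne_zero hl2 hT),
      MvPolynomial.totalDegree_mul_of_isDomain hl2 hT] at hPd
    have := lin_deg d hn1
    have := lin_deg d' hn2
    omega
  have hint := hmom (fun x => MvPolynomial.eval (fun i => x i) T) ⟨T, hdeg, fun _ => rfl⟩
  have hcont : ∀ W : MvPolynomial (Fin 2) ℝ,
      Continuous (fun x : Plane => MvPolynomial.eval (fun i => x i) W) := by
    intro W
    exact (MvPolynomial.continuous_eval W).comp (by fun_prop)
  have hqc : Continuous q := by
    rw [funext hqP]; exact hcont P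
  have hform : ∀ x : Plane, q x * MvPolynomial.eval (fun i => x i) T =
      (d - a * x 0 - b * x 1) * (d' - a' * x 0 - b' * x 1) *
        (MvPolynomial.eval (fun i => x i) T) ^ 2 := by
    intro x
    rw [hqP, hR, map_mul, map_mul, lin_eval, lin_eval]; ring
  have hgc : Continuous (fun x : Plane => q x * MvPolynomial.eval (fun i => x i) T) :=
    hqc.mul (hcont T)
  apply hT
  apply zero_of_open T _ isOpen_interior ⟨c, hc⟩
  have hio : IntegrableOn (fun x : Plane => q x * MvPolynomial.eval (fun i => x i) T)
      (interior (convexHull ℝ (S : Set Plane))) :=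
    (hgc.continuousOn.integrableOn_compact hK).mono_set interior_subset
  rw [setIntegral_eq_zero_iff_of_nonneg_ae ?_ hio] at hint
  · have hz := Measure.eqOn_open_of_ae_eq hint isOpen_interior hgc.continuousOn continuousOn_const
    intro x hx
    have h0 := hz hx
    simp only [Pi.zero_apply] at h0
    rw [hform] at h0
    have := hpos1 x hx
    have := hpos2 x hx
    have hp : 0 < (d - a * x 0 - b * x 1) * (d' - a' * x 0 - b' * x 1) :=
      mul_pos (by linarith) (by linarith)
    rcases mul_eq_zero.1 h0 with h | h
    · exact absurd h hp.ne'
    · exact pow_eq_zero_iff (two_ne_zero) |>.1 h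
  · refine (ae_restrict_iff' isOpen_interior.measurableSet).2 (Filter.Eventually.of_forall ?_)
    intro x hx
    have := hpos1 x hx
    have := hpos2 x hx
    simp only [Pi.zero_apply]
    rw [hform]
    exact mul_nonneg (mul_nonneg (by linarith) (by linarith)) (sq_nonneg _)
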